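/- arXiv:2410.05524 — 3 statements merged into one kernel-verified Lean document; each statement's English description precedes it below -/
import Mathlib

section
/- Let U1, U2 : [0,∞) → ℝ be strictly increasing, strictly concave, continuously differentiable with U1(0) = U2(0) = 0 and lim_{z→∞} U1'(z) = 0, let r > 0, and let η > r satisfy the tangency equation U1(η − r) + U2(r) − η·U1'(η − r) = 0. Define the dual utility Ũ(y, r) = sup_{x > 0} { U(x − r) − x·y } for y > 0, and Ũ1(y) = sup_{x > 0} { U1(x) − x·y }. Then Ũ(y, r) = Ũ1(y) − r·y whenever 0 < y ≤ U1'(η − r), and Ũ(y, r) = −U2(r) whenever y > U1'(η − r). -/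
open Set Filter Topology

/-- A concave function on `[0, ∞)` lies below each of its tangent lines. -/
lemma ConcaveOn.le_tangent_of_hasDerivWithinAt {f : ℝ → ℝ} {d b x : ℝ}
    (hf : ConcaveOn ℝ (Ici 0) f) (hd : HasDerivWithinAt f d (Ici 0) b)
    (hb : 0 ≤ b) (hx : 0 ≤ x) : f x ≤ f b + d * (x - b) := by
  rcases lt_trichotomy x b with h | h | h
  · have hs := hf.le_slope_of_hasDerivWithinAt hx hb h hd
    rw [slope_def_field, le_div_iff₀ (sub_pos.2 h)] at hs
    linarith
  · simp [h]
  · have hs := hf.slope_le_of_hasDerivWithinAt hb hx h hd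
    rw [slope_def_field, div_le_iff₀ (sub_pos.2 h)] at hs
    linarith

/-- The chord inequality for a concave function vanishing at the origin. -/
lemma ConcaveOn.mul_le_mul_of_map_zero {f : ℝ → ℝ} {t r : ℝ}
    (hf : ConcaveOn ℝ (Ici 0) f) (h0 : f 0 = 0) (ht : 0 ≤ t) (htr : t ≤ r) (hr : 0 < r) :
    t * f r ≤ r * f t := by
  have h := hf.2 (mem_Ici.2 le_rfl) (mem_Ici.2 hr.le)
    (sub_nonneg.2 ((div_le_one hr).2 htr)) (div_nonneg ht hr.le) (by ring)
  have e : t / r * r = t := div_mul_cancel₀ t hr.ne'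
  simp only [smul_eq_mul, mul_zero, zero_add, h0, e] at h
  calc t * f r = r * (t / r * f r) := by field_simp
    _ ≤ r * f t := mul_le_mul_of_nonneg_left h hr.le

/-- A continuous function on `[0, ∞)` tending to `0` takes, at or to the right of a point `a`,
every positive value not exceeding its value at `a`. -/
lemma exists_ge_eq_of_tendsto_zero {g : ℝ → ℝ} {a y : ℝ} (hg : ContinuousOn g (Ici 0))
    (hlim : Tendsto g atTop (𝓝 0)) (ha : 0 ≤ a) (hy : 0 < y) (hya : y ≤ g a) :
    ∃ b, a ≤ b ∧ g b = y := by
  obtain ⟨c, hc, hac⟩ := ((hlim.eventually_lt_const hy).and (eventually_ge_atTop a)).exists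
  obtain ⟨b, hb, hby⟩ := intermediate_value_Icc' hac
    (hg.mono fun z hz => ha.trans hz.1) ⟨hc.le, hya⟩
  exact ⟨b, hb.1, hby⟩

/-- structure of the dual (Fenchel–Legendre transformed) utility. -/
theorem dual_utility_structure (U1 U1' U2 U2' : ℝ → ℝ) (r η : ℝ)
    (hU1mono : StrictMonoOn U1 (Ici 0))
    (hU1conc : StrictConcaveOn ℝ (Ici 0) U1)
    (hU1deriv : ∀ z ∈ Ici (0:ℝ), HasDerivWithinAt U1 (U1' z) (Ici 0) z)
    (hU1derivCont : ContinuousOn U1' (Ici 0))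
    (hU10 : U1 0 = 0)
    (hU1'infty : Tendsto U1' atTop (𝓝 0))
    (hU2mono : StrictMonoOn U2 (Ici 0))
    (hU2conc : StrictConcaveOn ℝ (Ici 0) U2)
    (hU2deriv : ∀ z ∈ Ici (0:ℝ), HasDerivWithinAt U2 (U2' z) (Ici 0) z)
    (hU2derivCont : ContinuousOn U2' (Ici 0))
    (hU20 : U2 0 = 0)
    (hr : 0 < r) (hη : r < η)
    (htan : U1 (η - r) + U2 r - η * U1' (η - r) = 0)
    (U : ℝ → ℝ) (Udual : ℝ → ℝ) (U1dual : ℝ → ℝ)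
    (hU : ∀ z : ℝ, U z = if 0 ≤ z then U1 z else -(U2 (-z)))
    (hUdual : ∀ y, Udual y = sSup ((fun x => U (x - r) - x * y) '' Ioi 0))
    (hU1dual : ∀ y, U1dual y = sSup ((fun x => U1 x - x * y) '' Ioi 0)) :
    (∀ y : ℝ, 0 < y → y ≤ U1' (η - r) → Udual y = U1dual y - r * y) ∧
    (∀ y : ℝ, U1' (η - r) < y → Udual y = -(U2 r)) := by
  have ha : 0 < η - r := sub_pos.2 hη
  have htangent : ∀ b x : ℝ, 0 ≤ b → 0 ≤ x → U1 x ≤ U1 b + U1' b * (x - b) := fun b x hb hx =>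
    hU1conc.concaveOn.le_tangent_of_hasDerivWithinAt (hU1deriv b hb) hb hx
  have hUpos : ∀ x, r ≤ x → U (x - r) = U1 (x - r) := fun x hx => by
    rw [hU, if_pos (sub_nonneg.2 hx)]
  have hUneg : ∀ x, x < r → U (x - r) = -(U2 (r - x)) := fun x hx => by
    rw [hU, if_neg (by linarith), neg_sub]
  have henv : ∀ x, 0 < x → U (x - r) ≤ U1' (η - r) * x - U2 r := by
    have hge : ∀ x, r ≤ x → U1 (x - r) ≤ U1' (η - r) * x - U2 r := fun x hx => by
      have := htangent (η - r) (x - r) ha.le (sub_nonneg.2 hx)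
      linarith
    intro x hx
    rcases le_or_gt r x with h | h
    · rw [hUpos x h]
      exact hge x h
    · rw [hUneg x h]
      have hchord := hU2conc.concaveOn.mul_le_mul_of_map_zero hU20
        (sub_nonneg.2 h.le) (sub_le_self r hx.le) hr
      have hrr := hge r le_rfl
      rw [sub_self, hU10] at hrr
      have := mul_le_mul_of_nonneg_left hrr hx.le
      refine le_of_mul_le_mul_left ?_ hr
      linarith
  refine ⟨fun y hy hym => ?_, fun y hy => ?_⟩
  · obtain ⟨b, hab, rfl⟩ :=
      exists_ge_eq_of_tendsto_zero hU1derivCont hU1'infty ha.le hy hym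
    have hb : 0 < b := ha.trans_le hab
    have hmax : ∀ x, 0 ≤ x → U1 x - x * U1' b ≤ U1 b - b * U1' b := fun x hx => by
      have := htangent b x hb.le hx
      linarith
    have h1 : IsGreatest ((fun x => U1 x - x * U1' b) '' Ioi 0) (U1 b - b * U1' b) :=
      ⟨⟨b, hb, rfl⟩, by rintro _ ⟨x, hx, rfl⟩; exact hmax x (le_of_lt hx)⟩
    have h2 : IsGreatest ((fun x => U (x - r) - x * U1' b) '' Ioi 0)
        (U1 b - b * U1' b - r * U1' b) := by
      refine ⟨⟨b + r, add_pos hb hr, ?_⟩, ?_⟩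
      · dsimp only
        rw [hUpos (b + r) (by linarith), add_sub_cancel_right]
        ring
      · rintro _ ⟨x, hx, rfl⟩
        rcases le_or_gt r x with h | h
        · have := hmax (x - r) (sub_nonneg.2 h)
          simp only [hUpos x h]
          linarith
        · have hmx := mul_le_mul_of_nonneg_left (h.trans hη).le (sub_nonneg.2 hym)
          have := hmax (η - r) ha.le
          have := henv x hx
          dsimp only
          linarith
    rw [hUdual, hU1dual, h1.csSup_eq, h2.csSup_eq]
  · rw [hUdual]
    have hlim : Tendsto (fun x => U (x - r) - x * y) (𝓝[>] 0) (𝓝 (-(U2 r))) := by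
      have hc : ContinuousAt U2 r :=
        ((hU2deriv r hr.le).hasDerivAt (Ici_mem_nhds hr)).continuousAt
      have hsub : Tendsto (fun x : ℝ => r - x) (𝓝 0) (𝓝 r) := by
        simpa using (continuous_sub_left r).tendsto 0
      have hmul : Tendsto (fun x : ℝ => x * y) (𝓝 0) (𝓝 0) := by
        simpa using (continuous_mul_const y).tendsto 0
      have h := (((hc.tendsto.comp hsub).neg.sub hmul).mono_left
        (nhdsWithin_le_nhds (s := Ioi 0)))
      rw [sub_zero] at h
      refine h.congr' ?_
      filter_upwards [nhdsWithin_le_nhds (Iio_mem_nhds hr)] with x hx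
      simp [hUneg x hx]
    refine IsLUB.csSup_eq ⟨?_, fun c hc => ?_⟩ (nonempty_Ioi.image _)
    · rintro _ ⟨x, hx, rfl⟩
      have := mul_le_mul_of_nonneg_right hy.le (le_of_lt hx)
      have := henv x hx
      dsimp only
      linarith
    · refine le_of_tendsto hlim ?_
      filter_upwards [self_mem_nhdsWithin] with x hx
      exact hc ⟨x, hx, rfl⟩
end

section
/- With the closed-form setup (p, K, ᾱ, θ̄, R̄, ẑ, û, q, k as in the context), define D(τ, y) = −y^{1/(p−1)} · p^{1/(1−p)} · exp(−q(ᾱ − θ̄²/(2(p−1)))τ) · Φ(−k(τ,y) − q·θ̄√τ) − R̄ · e^{−ᾱτ} · Φ(−k(τ,y) − θ̄√τ). Then for every τ > 0 and y > 0, y ↦ D(τ, y) is differentiable at y with derivative ∂_y D(τ, y) = y^{(2−p)/(p−1)} · p^{1/(1−p)} · (1/(1−p)) · exp(−q(ᾱ − θ̄²/(2(p−1)))τ) · Φ(−k(τ,y) − q·θ̄√τ) + φ(k(τ,y)) · ẑ·û/(θ̄√τ·y²), and this derivative is strictly positive. -/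
open Set Filter Topology MeasureTheory ProbabilityTheory

theorem hasDerivAt_integral_Iic {f : ℝ → ℝ} (hf : Continuous f) (hint : Integrable f) (x : ℝ) :
    HasDerivAt (fun u => ∫ t in Iic u, f t) (f x) x := by
  have h : (fun u => ∫ t in Iic u, f t) =
      fun u => (∫ t in (0 : ℝ)..u, f t) + ∫ t in Iic (0 : ℝ), f t := by
    funext u
    rw [← intervalIntegral.integral_Iic_sub_Iic hint.integrableOn hint.integrableOn]
    ring
  rw [h]
  exact (hf.integral_hasStrictDerivAt 0 x).hasDerivAt.add_const _

theorem integrable_stdGaussian_density :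
    Integrable fun t : ℝ => (Real.sqrt (2 * Real.pi))⁻¹ * Real.exp (-(t ^ 2) / 2) := by
  refine ((integrable_exp_neg_mul_sq (b := 1 / 2) (by norm_num)).const_mul
    (Real.sqrt (2 * Real.pi))⁻¹).congr ?_
  refine Eventually.of_forall fun t => ?_
  dsimp only
  congr 2
  ring

/-- second derivative of the closed-form dual value function is
given explicitly and is strictly positive (strict convexity). -/
theorem dual_value_second_deriv
    (p K α θ R zHat uHat u₀ q : ℝ)
    (hp : 0 < p) (hp1 : p < 1) (hK : 0 ≤ K) (hθ : 0 < θ) (hR : 0 < R) (hzHat : R < zHat)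
    (htan : (zHat - R) ^ p + K * R ^ p = p * zHat * (zHat - R) ^ (p - 1))
    (huHat : uHat = p * (zHat - R) ^ (p - 1))
    (hu₀ : u₀ = -(K * R ^ p))
    (hq : q = p / (p - 1))
    (Φ : ℝ → ℝ)
    (hΦ : ∀ x, Φ x = ∫ t in Iic x, (Real.sqrt (2 * Real.pi))⁻¹ * Real.exp (-(t ^ 2) / 2))
    (k : ℝ → ℝ → ℝ)
    (hk : ∀ τ y, k τ y =
      (Real.log y - Real.log uHat - (α + θ ^ 2 / 2) * τ) / (θ * Real.sqrt τ))
    (φ : ℝ → ℝ)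
    (hφ : ∀ x, φ x = (Real.sqrt (2 * Real.pi))⁻¹ * Real.exp (-(x ^ 2) / 2))
    (D : ℝ → ℝ → ℝ)
    (hD : ∀ τ y, D τ y =
      -(y ^ (1 / (p - 1)) * p ^ (1 / (1 - p)) *
          Real.exp (-q * (α - θ ^ 2 / (2 * (p - 1))) * τ) *
          Φ (-(k τ y) - q * θ * Real.sqrt τ))
        - R * Real.exp (-α * τ) * Φ (-(k τ y) - θ * Real.sqrt τ)) :
    ∀ τ > (0:ℝ), ∀ y > (0:ℝ),
      HasDerivAt (fun z => D τ z)
        (y ^ ((2 - p) / (p - 1)) * p ^ (1 / (1 - p)) * (1 / (1 - p)) *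
            Real.exp (-q * (α - θ ^ 2 / (2 * (p - 1))) * τ) *
            Φ (-(k τ y) - q * θ * Real.sqrt τ)
          + φ (k τ y) * (zHat * uHat / (θ * Real.sqrt τ * y ^ 2))) y ∧
      0 < y ^ ((2 - p) / (p - 1)) * p ^ (1 / (1 - p)) * (1 / (1 - p)) *
            Real.exp (-q * (α - θ ^ 2 / (2 * (p - 1))) * τ) *
            Φ (-(k τ y) - q * θ * Real.sqrt τ)
          + φ (k τ y) * (zHat * uHat / (θ * Real.sqrt τ * y ^ 2)) := by
  intro τ hτ y hy
  have hφΦ : ∀ x, HasDerivAt Φ (φ x) x := by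
    intro x
    rw [funext hΦ, hφ]
    exact hasDerivAt_integral_Iic (by fun_prop) integrable_stdGaussian_density x
  have hΦ_nonneg : ∀ x, 0 ≤ Φ x := by
    intro x
    rw [hΦ]
    exact integral_nonneg fun t => by positivity
  have hφ_pos : ∀ x, 0 < φ x := by
    intro x
    rw [hφ]
    positivity
  have hw : 0 < zHat - R := sub_pos.mpr hzHat
  have hz : 0 < zHat := hR.trans hzHat
  have hu : 0 < uHat := by rw [huHat]; positivity
  have hp' : 0 < 1 - p := sub_pos.mpr hp1
  have hpm : p - 1 ≠ 0 := by linarith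
  have hs : 0 < θ * Real.sqrt τ := mul_pos hθ (Real.sqrt_pos.mpr hτ)
  have hs2 : (θ * Real.sqrt τ) ^ 2 = θ ^ 2 * τ := by rw [mul_pow, Real.sq_sqrt hτ.le]
  have hks : k τ y * (θ * Real.sqrt τ) =
      Real.log y - Real.log uHat - (α + θ ^ 2 / 2) * τ := by
    rw [hk]; field_simp
  have hsneg : ∀ c, φ (-(k τ y) - c) = φ (k τ y) * Real.exp (-(k τ y * c) - c ^ 2 / 2) := by
    intro c
    rw [hφ, hφ, mul_assoc, ← Real.exp_add]
    congr 2
    ring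
  have hlogu : Real.log uHat = Real.log p + (p - 1) * Real.log (zHat - R) := by
    rw [huHat, Real.log_mul hp.ne' (by positivity), Real.log_rpow hw]
  have hshift : Real.exp (-α * τ) * φ (-(k τ y) - θ * Real.sqrt τ) =
      φ (k τ y) * (uHat / y) := by
    rw [hsneg, hks, hs2, mul_left_comm, ← Real.exp_add, ← Real.exp_log (div_pos hu hy),
      Real.log_div hu.ne' hy.ne']
    congr 2
    ring
  have hqshift : y ^ (1 / (p - 1)) * p ^ (1 / (1 - p)) *
      Real.exp (-q * (α - θ ^ 2 / (2 * (p - 1))) * τ) *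
        φ (-(k τ y) - q * θ * Real.sqrt τ) =
      φ (k τ y) * ((zHat - R) * uHat / y) := by
    rw [mul_assoc q, hsneg, mul_left_comm (k τ y), hks, mul_pow, hs2, mul_left_comm _ (φ _),
      Real.rpow_def_of_pos hy, Real.rpow_def_of_pos hp, ← Real.exp_add, ← Real.exp_add,
      ← Real.exp_add, ← Real.exp_log (div_pos (mul_pos hw hu) hy),
      Real.log_div (mul_pos hw hu).ne' hy.ne', Real.log_mul hw.ne' hu.ne', hlogu, hq]
    congr 2
    have : 1 / (1 - p) = -(1 / (p - 1)) := by rw [← neg_sub p 1, one_div_neg_eq_neg_one_div]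
    rw [this]
    field_simp
    ring
  have hk_deriv : HasDerivAt (fun z => k τ z) (1 / (y * (θ * Real.sqrt τ))) y := by
    rw [funext (hk τ)]
    refine ((((Real.hasDerivAt_log hy.ne').sub_const _).sub_const _).div_const _).congr_deriv ?_
    field_simp
  have hΦk : ∀ c, HasDerivAt (fun z => Φ (-(k τ z) - c))
      (φ (-(k τ y) - c) * -(1 / (y * (θ * Real.sqrt τ)))) y := fun c =>
    (hφΦ _).comp y (hk_deriv.neg.sub_const c)
  have hpow : HasDerivAt (fun z : ℝ => z ^ (1 / (p - 1)))
      (-(1 / (1 - p)) * y ^ ((2 - p) / (p - 1))) y := by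
    refine (Real.hasDerivAt_rpow_const (Or.inl hy.ne')).congr_deriv ?_
    congr 1
    · rw [← neg_sub p 1, one_div_neg_eq_neg_one_div, neg_neg]
    · congr 1
      field_simp
      ring
  constructor
  · rw [funext (hD τ)]
    refine (((((hpow.mul_const _).mul_const _).mul (hΦk _)).neg).sub
      ((hΦk _).const_mul (R * Real.exp (-α * τ)))).congr_deriv ?_
    have hsum : φ (k τ y) * (zHat * uHat / (θ * Real.sqrt τ * y ^ 2)) =
        (φ (k τ y) * ((zHat - R) * uHat / y) + R * (φ (k τ y) * (uHat / y))) *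
          (1 / (y * (θ * Real.sqrt τ))) := by
      have := (Real.sqrt_pos.mpr hτ).ne'
      field_simp
      ring
    rw [hsum, ← hqshift, ← hshift]
    ring
  · have := hΦ_nonneg (-(k τ y) - q * θ * Real.sqrt τ)
    have := hφ_pos (k τ y)
    positivity
end

section
/- With the closed-form setup (p, K, ᾱ, θ̄, R̄, ẑ, û, u₀, q, k, G̃, Ũ as in the context), for every y > 0 with y ≠ û one has lim_{τ→0+} G̃(τ, y) = Ũ(y); that is, the closed-form dual value function attains the dual utility as terminal condition away from the kink point û. -/
open Set Filter Topology MeasureTheory ProbabilityTheory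

/-- The standard normal distribution function, written as an integral, is the `cdf` of
`gaussianReal 0 1`. -/
theorem integral_Iic_eq_cdf_gaussianReal (x : ℝ) :
    ∫ t in Iic x, (Real.sqrt (2 * Real.pi))⁻¹ * Real.exp (-(t ^ 2) / 2) =
      cdf (gaussianReal 0 1) x := by
  rw [cdf_eq_real, measureReal_def, gaussianReal_apply_eq_integral 0 one_ne_zero,
    ENNReal.toReal_ofReal (integral_nonneg fun t => gaussianPDFReal_nonneg _ _ _)]
  simp [gaussianPDFReal]

theorem tendsto_inv_const_mul_sqrt_atTop {θ : ℝ} (hθ : 0 < θ) :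
    Tendsto (fun τ : ℝ => (θ * Real.sqrt τ)⁻¹) (𝓝[>] 0) atTop := by
  refine Tendsto.inv_tendsto_nhdsGT_zero (tendsto_nhdsWithin_iff.mpr ⟨?_, ?_⟩)
  · have h : Continuous fun τ : ℝ => θ * Real.sqrt τ := by fun_prop
    simpa using (h.tendsto 0).mono_left nhdsWithin_le_nhds
  · filter_upwards [self_mem_nhdsWithin] with τ hτ
    exact mul_pos hθ (Real.sqrt_pos.mpr hτ)

theorem tendsto_sub_mul_div_sqrt_atTop {θ c : ℝ} (d : ℝ) (hθ : 0 < θ) (hc : 0 < c) :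
    Tendsto (fun τ : ℝ => (c - d * τ) / (θ * Real.sqrt τ)) (𝓝[>] 0) atTop := by
  have h : Continuous fun τ : ℝ => c - d * τ := by fun_prop
  have h' : Tendsto (fun τ : ℝ => c - d * τ) (𝓝[>] 0) (𝓝 c) := by
    simpa using (h.tendsto 0).mono_left nhdsWithin_le_nhds
  simpa only [div_eq_mul_inv] using h'.pos_mul_atTop hc (tendsto_inv_const_mul_sqrt_atTop hθ)

theorem tendsto_sub_mul_div_sqrt_atBot {θ c : ℝ} (d : ℝ) (hθ : 0 < θ) (hc : c < 0) :
    Tendsto (fun τ : ℝ => (c - d * τ) / (θ * Real.sqrt τ)) (𝓝[>] 0) atBot := by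
  have h : Continuous fun τ : ℝ => c - d * τ := by fun_prop
  have h' : Tendsto (fun τ : ℝ => c - d * τ) (𝓝[>] 0) (𝓝 c) := by
    simpa using (h.tendsto 0).mono_left nhdsWithin_le_nhds
  simpa only [div_eq_mul_inv] using h'.neg_mul_atTop hc (tendsto_inv_const_mul_sqrt_atTop hθ)



/-- away from the kink uHat, the closed-form dual value function
attains the dual utility as terminal condition: G(τ, y) → Utilde(y) as τ → 0+. -/
theorem dual_value_terminal_condition
    (p K α θ R zHat uHat u₀ q : ℝ)
    (hp : 0 < p) (hp1 : p < 1) (hK : 0 ≤ K) (hθ : 0 < θ) (hR : 0 < R) (hzHat : R < zHat)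
    (htan : (zHat - R) ^ p + K * R ^ p = p * zHat * (zHat - R) ^ (p - 1))
    (huHat : uHat = p * (zHat - R) ^ (p - 1))
    (hu₀ : u₀ = -(K * R ^ p))
    (hq : q = p / (p - 1))
    (Φ : ℝ → ℝ)
    (hΦ : ∀ x, Φ x = ∫ t in Iic x, (Real.sqrt (2 * Real.pi))⁻¹ * Real.exp (-(t ^ 2) / 2))
    (k : ℝ → ℝ → ℝ)
    (hk : ∀ τ y, k τ y =
      (Real.log y - Real.log uHat - (α + θ ^ 2 / 2) * τ) / (θ * Real.sqrt τ))
    (G : ℝ → ℝ → ℝ)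
    (hG : ∀ τ y, G τ y =
      y ^ q * p ^ (-q) * (1 - p) * Real.exp (-q * (α - θ ^ 2 / (2 * (p - 1))) * τ) *
          Φ (-(k τ y) - q * θ * Real.sqrt τ)
        - R * y * Real.exp (-α * τ) * Φ (-(k τ y) - θ * Real.sqrt τ)
        + u₀ * Φ (k τ y))
    (Utilde : ℝ → ℝ)
    (hUtilde : ∀ y : ℝ, 0 < y →
      Utilde y = if y ≤ uHat then (1 - p) * (y / p) ^ q - R * y else -(K * R ^ p)) :
    ∀ y > (0:ℝ), y ≠ uHat →
      Tendsto (fun τ => G τ y) (𝓝[>] 0) (𝓝 (Utilde y)) := by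
  intro y hy hyu
  have hΦcdf : Φ = cdf (gaussianReal 0 1) :=
    funext fun x => (hΦ x).trans (integral_Iic_eq_cdf_gaussianReal x)
  have hΦbot : Tendsto Φ atBot (𝓝 0) := hΦcdf ▸ tendsto_cdf_atBot _
  have hΦtop : Tendsto Φ atTop (𝓝 1) := hΦcdf ▸ tendsto_cdf_atTop _
  have hu : 0 < uHat := huHat ▸ mul_pos hp (Real.rpow_pos_of_pos (sub_pos.mpr hzHat) _)
  have hexp (c : ℝ) : Tendsto (fun τ : ℝ => Real.exp (c * τ)) (𝓝[>] 0) (𝓝 1) := by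
    have h : Continuous fun τ : ℝ => Real.exp (c * τ) := by fun_prop
    simpa using (h.tendsto 0).mono_left nhdsWithin_le_nhds
  have hsqrt (c : ℝ) : Tendsto (fun τ : ℝ => -(c * Real.sqrt τ)) (𝓝[>] 0) (𝓝 0) := by
    have h : Continuous fun τ : ℝ => -(c * Real.sqrt τ) := by fun_prop
    simpa using (h.tendsto 0).mono_left nhdsWithin_le_nhds
  have hG_lim {a b : ℝ}
      (ha : ∀ c : ℝ, Tendsto (fun τ => Φ (-(k τ y) - c * Real.sqrt τ)) (𝓝[>] 0) (𝓝 a))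
      (hb : Tendsto (fun τ => Φ (k τ y)) (𝓝[>] 0) (𝓝 b)) :
      Tendsto (fun τ => G τ y) (𝓝[>] 0)
        (𝓝 (y ^ q * p ^ (-q) * (1 - p) * 1 * a - R * y * 1 * a + u₀ * b)) := by
    simp only [hG]
    exact ((((hexp _).const_mul _).mul (ha (q * θ))).sub
      (((hexp _).const_mul _).mul (ha θ))).add (hb.const_mul _)
  rw [hUtilde y hy]
  rcases lt_or_gt_of_ne hyu with hlt | hgt
  · have hk_lim : Tendsto (fun τ => k τ y) (𝓝[>] 0) atBot := by
      simp only [hk]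
      exact tendsto_sub_mul_div_sqrt_atBot _ hθ (sub_neg.mpr (Real.log_lt_log hy hlt))
    have hlim := hG_lim (a := 1)
      (fun c => hΦtop.comp ((tendsto_neg_atBot_atTop.comp hk_lim).atTop_add (hsqrt c)))
      (hΦbot.comp hk_lim)
    rw [if_pos hlt.le]
    convert hlim using 2
    rw [Real.div_rpow hy.le hp.le, Real.rpow_neg hp.le]
    ring
  · have hk_lim : Tendsto (fun τ => k τ y) (𝓝[>] 0) atTop := by
      simp only [hk]
      exact tendsto_sub_mul_div_sqrt_atTop _ hθ (sub_pos.mpr (Real.log_lt_log hu hgt))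
    have hlim := hG_lim (a := 0)
      (fun c => hΦbot.comp ((tendsto_neg_atTop_atBot.comp hk_lim).atBot_add (hsqrt c)))
      (hΦtop.comp hk_lim)
    rw [if_neg hgt.not_ge]
    convert hlim using 2
    rw [hu₀]
    ring
end
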